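/- Let d ≥ 1 and let ℓ : [0,∞) → [0,∞) satisfy (A1,i): ℓ(0) = 0 and ℓ(ru) ≥ rℓ(u) for all r ∈ (0,1), u > 0. Let P₀, P₁ be Borel probability measures on ℝ^d and B a set of Borel probability measures on [0,∞). If (X₀,X₁,M) is a minimizer of T^V(P₀,P₁;B) and A ⊆ [0,1] is a random measurable set on the same probability space with P(|A| = |X₁−X₀|/M | M > 0) = 1, then (X(·; X₀, X₁, A), M) is a minimizer of V(P₀,P₁;B). -/

import Mathlib

open MeasureTheory Set Filter
open scoped ENNReal NNReal Classical

noncomputable section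

/-- `ℝ^d` with the Euclidean norm. -/
abbrev Vec (d : ℕ) := EuclideanSpace ℝ (Fin d)

/-- essential supremum of `|φ|` on `[0,t]` (`‖φ‖_{∞,t}`), as an extended nonnegative real. -/
def eSupT {d : ℕ} (φ : ℝ → Vec d) (t : ℝ) : ℝ≥0∞ :=
  essSup (fun s => (‖φ s‖₊ : ℝ≥0∞)) (volume.restrict (Icc (0:ℝ) t))

/-- `‖φ‖_∞` on `[0,1]`. -/
def eSup01 {d : ℕ} (φ : ℝ → Vec d) : ℝ≥0∞ := eSupT φ 1

/-- `N₁(φ)_t`. -/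
def N1T {d : ℕ} (φ : ℝ → Vec d) (t : ℝ) : ℝ :=
  if (∫ s in (0:ℝ)..t, φ s) ≠ 0 then t * (eSupT φ t).toReal / ‖∫ s in (0:ℝ)..t, φ s‖ else 1

/-- `N₂(φ)_t`. -/
def N2T {d : ℕ} (φ : ℝ → Vec d) (t : ℝ) : ℝ :=
  if 0 < (∫ s in (0:ℝ)..t, ‖φ s‖) then t * (eSupT φ t).toReal / (∫ s in (0:ℝ)..t, ‖φ s‖) else 1

/-- `N₁(φ) = N₁(φ)₁`. -/
def N1 {d : ℕ} (φ : ℝ → Vec d) : ℝ := N1T φ 1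

/-- `N₂(φ) = N₂(φ)₁`. -/
def N2 {d : ℕ} (φ : ℝ → Vec d) : ℝ := N2T φ 1

/-- the position at time `t` of the absolutely continuous path starting at `ξ`
with velocity `φ`. -/
def pathAt {d : ℕ} (ξ : Vec d) (φ : ℝ → Vec d) (t : ℝ) : Vec d := ξ + ∫ s in (0:ℝ)..t, φ s

/-- the endpoint `X(1)` of the path starting at `ξ` with velocity `φ`. -/
def endPt {d : ℕ} (ξ : Vec d) (φ : ℝ → Vec d) : Vec d := ξ + ∫ s in (0:ℝ)..1, φ s

/-- The Monge–Kantorovich cost `T(P₀,P₁) = inf E[L(X₁ - X₀)]`, the infimum being over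
pairs of random variables, on some probability space, with laws `P₀` and `P₁`. -/
def MKcost {d : ℕ} (L : Vec d → ℝ) (P₀ P₁ : Measure (Vec d)) : ℝ≥0∞ :=
  sInf { c | ∃ (Ω : Type) (_ : MeasureSpace Ω), IsProbabilityMeasure (volume : Measure Ω) ∧
    ∃ (X₀ X₁ : Ω → Vec d), Measurable X₀ ∧ Measurable X₁ ∧
      Measure.map X₀ volume = P₀ ∧ Measure.map X₁ volume = P₁ ∧
      c = ∫⁻ ω, ENNReal.ofReal (L (X₁ ω - X₀ ω)) }

/-- `(X₀, X₁)` is a minimizer of `T(P₀,P₁)`. -/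
def IsTMin {d : ℕ} (L : Vec d → ℝ) (P₀ P₁ : Measure (Vec d)) (Ω : Type) [MeasureSpace Ω]
    (X₀ X₁ : Ω → Vec d) : Prop :=
  IsProbabilityMeasure (volume : Measure Ω) ∧ Measurable X₀ ∧ Measurable X₁ ∧
  Measure.map X₀ volume = P₀ ∧ Measure.map X₁ volume = P₁ ∧
  (∫⁻ ω, ENNReal.ofReal (L (X₁ ω - X₀ ω))) = MKcost L P₀ P₁

/-- The stochastic process determined by the (measurable) initial point `ξ` and velocity
process `φ`, namely `X(ω,t) = ξ ω + ∫₀ᵗ φ(ω,s) ds`, is a member of `𝒜_∞(P₀,P₁)`: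
its paths are a.s. absolutely continuous with essentially bounded derivative and
`X(0), X(1)` have laws `P₀, P₁`. -/
def IsAdmissible {d : ℕ} (P₀ P₁ : Measure (Vec d)) (Ω : Type) [MeasureSpace Ω]
    (ξ : Ω → Vec d) (φ : Ω → ℝ → Vec d) : Prop :=
  IsProbabilityMeasure (volume : Measure Ω) ∧ Measurable ξ ∧ Measurable (Function.uncurry φ) ∧
  (∀ᵐ ω ∂(volume : Measure Ω), eSup01 (φ ω) < ⊤) ∧
  Measure.map ξ volume = P₀ ∧ Measure.map (fun ω => endPt (ξ ω) (φ ω)) volume = P₁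

/-- `∫₀¹ Lᵢ(t, φ) dt` where `Lᵢ(t,φ) = Nᵢ(φ) ℓ(|φ(t)|/Nᵢ(φ))`; `N` is `N₁` or `N₂`. -/
def pathCost {d : ℕ} (ℓ : ℝ → ℝ) (N : (ℝ → Vec d) → ℝ) (φ : ℝ → Vec d) : ℝ≥0∞ :=
  ∫⁻ t in Icc (0:ℝ) 1, ENNReal.ofReal (N φ * ℓ (‖φ t‖ / N φ))

/-- The modified Lagrangian cost `Ṽᵢ(P₀,P₁)`; take `N := N₁` resp. `N := N₂`. -/
def Vtilde {d : ℕ} (ℓ : ℝ → ℝ) (N : (ℝ → Vec d) → ℝ) (P₀ P₁ : Measure (Vec d)) : ℝ≥0∞ :=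
  sInf { c | ∃ (Ω : Type) (_ : MeasureSpace Ω) (ξ : Ω → Vec d) (φ : Ω → ℝ → Vec d),
    IsAdmissible P₀ P₁ Ω ξ φ ∧ c = ∫⁻ ω, pathCost ℓ N (φ ω) }

/-- `X(·)` (given by start `ξ` and velocity `φ`) is a minimizer of `Ṽᵢ(P₀,P₁)`. -/
def IsVtildeMin {d : ℕ} (ℓ : ℝ → ℝ) (N : (ℝ → Vec d) → ℝ) (P₀ P₁ : Measure (Vec d))
    (Ω : Type) [MeasureSpace Ω] (ξ : Ω → Vec d) (φ : Ω → ℝ → Vec d) : Prop :=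
  IsAdmissible P₀ P₁ Ω ξ φ ∧ (∫⁻ ω, pathCost ℓ N (φ ω)) = Vtilde ℓ N P₀ P₁

/-- `X(t;x,y,A) = x + (|A∩[0,t]|/|A|)(y-x)` if `x ≠ y` and `|A| > 0`, else `x`
(for `A ⊆ [0,1]`). -/
def XPath {d : ℕ} (x y : Vec d) (A : Set ℝ) (t : ℝ) : Vec d :=
  if x ≠ y ∧ 0 < volume A then
    x + (((volume (A ∩ Icc (0:ℝ) t)).toReal) / ((volume A).toReal)) • (y - x)
  else x

/-- the velocity (a.e. derivative) of `t ↦ X(t;x,y,A)` (for `A ⊆ [0,1]`). -/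
def XVel {d : ℕ} (x y : Vec d) (A : Set ℝ) (s : ℝ) : Vec d :=
  if x ≠ y ∧ 0 < volume A then
    (if s ∈ A then ((volume A).toReal)⁻¹ • (y - x) else 0)
  else 0

/-- `A : Ω → Set ℝ` is a random measurable subset of `[0,1]`. -/
def IsRandomSet (Ω : Type) [MeasureSpace Ω] (A : Ω → Set ℝ) : Prop :=
  (∀ ω, A ω ⊆ Icc (0:ℝ) 1) ∧ MeasurableSet {p : Ω × ℝ | p.2 ∈ A p.1}

/-- `V(P₀,P₁;B)`: the value of the stochastic optimal transport over pairs `(X,M)` with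
`X ∈ 𝒜_∞(P₀,P₁)`, `M` a nonnegative random variable with law in `B` and `‖X'‖_∞ ≤ M` a.s. -/
def Vval {d : ℕ} (ℓ : ℝ → ℝ) (P₀ P₁ : Measure (Vec d)) (B : Set (Measure ℝ)) : ℝ≥0∞ :=
  sInf { c | ∃ (Ω : Type) (_ : MeasureSpace Ω), IsProbabilityMeasure (volume : Measure Ω) ∧
    ∃ (ξ : Ω → Vec d) (φ : Ω → ℝ → Vec d) (M : Ω → ℝ),
      Measurable ξ ∧ Measurable (Function.uncurry φ) ∧ Measurable M ∧
      (∀ᵐ ω ∂(volume : Measure Ω), 0 ≤ M ω) ∧ Measure.map M volume ∈ B ∧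
      (∀ᵐ ω ∂(volume : Measure Ω), eSup01 (φ ω) ≤ ENNReal.ofReal (M ω)) ∧
      Measure.map ξ volume = P₀ ∧ Measure.map (fun ω => endPt (ξ ω) (φ ω)) volume = P₁ ∧
      c = ∫⁻ ω, ∫⁻ t in Icc (0:ℝ) 1, ENNReal.ofReal (ℓ ‖φ ω t‖) }

/-- `T^V(P₀,P₁;B) = inf E[ℓ(M) M⁻¹ |X₁-X₀| ; M > 0]` over `(X₀,X₁,M) ∈ Π_∞(P₀,P₁;B)`. -/
def TVval {d : ℕ} (ℓ : ℝ → ℝ) (P₀ P₁ : Measure (Vec d)) (B : Set (Measure ℝ)) : ℝ≥0∞ :=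
  sInf { c | ∃ (Ω : Type) (_ : MeasureSpace Ω), IsProbabilityMeasure (volume : Measure Ω) ∧
    ∃ (X₀ X₁ : Ω → Vec d) (M : Ω → ℝ),
      Measurable X₀ ∧ Measurable X₁ ∧ Measurable M ∧
      (∀ᵐ ω ∂(volume : Measure Ω), 0 ≤ M ω) ∧ Measure.map M volume ∈ B ∧
      (∀ᵐ ω ∂(volume : Measure Ω), ‖X₁ ω - X₀ ω‖ ≤ M ω) ∧
      Measure.map X₀ volume = P₀ ∧ Measure.map X₁ volume = P₁ ∧
      c = ∫⁻ ω in {ω | 0 < M ω}, ENNReal.ofReal (ℓ (M ω) / M ω * ‖X₁ ω - X₀ ω‖) }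

/-- `((ξ,φ), M)` is an admissible pair for `V(P₀,P₁;B)`. -/
def IsVvalAdmissible {d : ℕ} (P₀ P₁ : Measure (Vec d)) (B : Set (Measure ℝ)) (Ω : Type)
    [MeasureSpace Ω] (ξ : Ω → Vec d) (φ : Ω → ℝ → Vec d) (M : Ω → ℝ) : Prop :=
  IsProbabilityMeasure (volume : Measure Ω) ∧
  Measurable ξ ∧ Measurable (Function.uncurry φ) ∧ Measurable M ∧
  (∀ᵐ ω ∂(volume : Measure Ω), 0 ≤ M ω) ∧ Measure.map M volume ∈ B ∧
  (∀ᵐ ω ∂(volume : Measure Ω), eSup01 (φ ω) ≤ ENNReal.ofReal (M ω)) ∧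
  Measure.map ξ volume = P₀ ∧ Measure.map (fun ω => endPt (ξ ω) (φ ω)) volume = P₁

/-- `((ξ,φ), M)` is a minimizer of `V(P₀,P₁;B)`. -/
def IsVvalMin {d : ℕ} (ℓ : ℝ → ℝ) (P₀ P₁ : Measure (Vec d)) (B : Set (Measure ℝ)) (Ω : Type)
    [MeasureSpace Ω] (ξ : Ω → Vec d) (φ : Ω → ℝ → Vec d) (M : Ω → ℝ) : Prop :=
  IsVvalAdmissible P₀ P₁ B Ω ξ φ M ∧
  (∫⁻ ω, ∫⁻ t in Icc (0:ℝ) 1, ENNReal.ofReal (ℓ ‖φ ω t‖)) = Vval ℓ P₀ P₁ B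

/-- `(X₀,X₁,M)` is an admissible triplet in `Π_∞(P₀,P₁;B)`. -/
def IsTVAdmissible {d : ℕ} (P₀ P₁ : Measure (Vec d)) (B : Set (Measure ℝ)) (Ω : Type)
    [MeasureSpace Ω] (X₀ X₁ : Ω → Vec d) (M : Ω → ℝ) : Prop :=
  IsProbabilityMeasure (volume : Measure Ω) ∧ Measurable X₀ ∧ Measurable X₁ ∧ Measurable M ∧
  (∀ᵐ ω ∂(volume : Measure Ω), 0 ≤ M ω) ∧ Measure.map M volume ∈ B ∧
  (∀ᵐ ω ∂(volume : Measure Ω), ‖X₁ ω - X₀ ω‖ ≤ M ω) ∧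
  Measure.map X₀ volume = P₀ ∧ Measure.map X₁ volume = P₁

/-- `(X₀,X₁,M)` is a minimizer of `T^V(P₀,P₁;B)`. -/
def IsTVMin {d : ℕ} (ℓ : ℝ → ℝ) (P₀ P₁ : Measure (Vec d)) (B : Set (Measure ℝ)) (Ω : Type)
    [MeasureSpace Ω] (X₀ X₁ : Ω → Vec d) (M : Ω → ℝ) : Prop :=
  IsTVAdmissible P₀ P₁ B Ω X₀ X₁ M ∧
  (∫⁻ ω in {ω | 0 < M ω}, ENNReal.ofReal (ℓ (M ω) / M ω * ‖X₁ ω - X₀ ω‖)) = TVval ℓ P₀ P₁ B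


/-- the unconstrained value `inf{E[∫₀¹ ℓ(|X'(t)|) dt] : X ∈ 𝒜_∞(P₀,P₁)}`. -/
def VInfPlain {d : ℕ} (ℓ : ℝ → ℝ) (P₀ P₁ : Measure (Vec d)) : ℝ≥0∞ :=
  sInf { c | ∃ (Ω : Type) (_ : MeasureSpace Ω) (ξ : Ω → Vec d) (φ : Ω → ℝ → Vec d),
    IsAdmissible P₀ P₁ Ω ξ φ ∧ c = ∫⁻ ω, ∫⁻ t in Icc (0:ℝ) 1, ENNReal.ofReal (ℓ ‖φ ω t‖) }

/-- the value `V(P₀,P₁) = inf{E[∫₀¹ L(X'(t)) dt] : X ∈ 𝒜(P₀,P₁)}`, over stochastic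
processes with a.s. absolutely continuous (integrable derivative) paths. -/
def Vplain {d : ℕ} (L : Vec d → ℝ) (P₀ P₁ : Measure (Vec d)) : ℝ≥0∞ :=
  sInf { c | ∃ (Ω : Type) (_ : MeasureSpace Ω), IsProbabilityMeasure (volume : Measure Ω) ∧
    ∃ (ξ : Ω → Vec d) (φ : Ω → ℝ → Vec d),
      Measurable ξ ∧ Measurable (Function.uncurry φ) ∧
      (∀ᵐ ω ∂(volume : Measure Ω), IntegrableOn (φ ω) (Icc (0:ℝ) 1)) ∧
      Measure.map ξ volume = P₀ ∧ Measure.map (fun ω => endPt (ξ ω) (φ ω)) volume = P₁ ∧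
      c = ∫⁻ ω, ∫⁻ t in Icc (0:ℝ) 1, ENNReal.ofReal (L (φ ω t)) }

/-- the (topological) support of a Borel measure on `ℝ^d`. -/
def msupport {d : ℕ} (μ : Measure (Vec d)) : Set (Vec d) :=
  {x | ∀ ε : ℝ, 0 < ε → 0 < μ (Metric.ball x ε)}

end
/-- Under (A1,i), `ℓ(M)/M * u ≤ ℓ(u)` for `0 ≤ u ≤ M`. -/
theorem aux_ell (ℓ : ℝ → ℝ) (hℓ0 : ℓ 0 = 0)
    (hA1i : ∀ r u : ℝ, 0 < r → r < 1 → 0 < u → r * ℓ u ≤ ℓ (r * u))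
    (M u : ℝ) (hM : 0 < M) (hu : 0 ≤ u) (huM : u ≤ M) : ℓ M / M * u ≤ ℓ u := by
  rcases hu.eq_or_lt with rfl | hu
  · simp [hℓ0]
  rcases huM.eq_or_lt with rfl | huM
  · rw [div_mul_cancel₀ _ hM.ne']
  have h := hA1i (u / M) M (by positivity) ((div_lt_one hM).2 huM) hM
  rw [div_mul_cancel₀ _ hM.ne'] at h
  calc ℓ M / M * u = u / M * ℓ M := by ring
    _ ≤ _ := h

theorem aux_ae_norm_le {d : ℕ} (φ : ℝ → Vec d) (M : ℝ) (hM : 0 ≤ M)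
    (h : eSup01 φ ≤ ENNReal.ofReal M) :
    ∀ᵐ t ∂(volume.restrict (Icc (0:ℝ) 1)), ‖φ t‖ ≤ M := by
  have h1 := ENNReal.ae_le_essSup (μ := volume.restrict (Icc (0:ℝ) 1))
    (fun s => (‖φ s‖₊ : ℝ≥0∞))
  filter_upwards [h1] with t ht
  have h2 : (‖φ t‖₊ : ℝ≥0∞) ≤ ENNReal.ofReal M := ht.trans h
  have h3 := (ENNReal.le_ofReal_iff_toReal_le ENNReal.coe_ne_top hM).1 h2
  simpa using h3

theorem aux_integral_le {d : ℕ} (φ : ℝ → Vec d) (M : ℝ) (hM : 0 ≤ M)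
    (h : eSup01 φ ≤ ENNReal.ofReal M) : ‖∫ s in (0:ℝ)..1, φ s‖ ≤ M := by
  have h1 := aux_ae_norm_le φ M hM h
  have h2 : ∀ᵐ t, t ∈ Set.uIoc (0:ℝ) 1 → ‖φ t‖ ≤ M := by
    have h3 := (ae_restrict_iff' (measurableSet_Icc)).1 h1
    filter_upwards [h3] with t ht hmem
    rw [Set.uIoc_of_le zero_le_one] at hmem
    exact ht ⟨hmem.1.le, hmem.2⟩
  have h4 := intervalIntegral.norm_integral_le_of_norm_le_const_ae h2
  simpa using h4

theorem aux_lower {d : ℕ} (ℓ : ℝ → ℝ) (hℓnn : ∀ u : ℝ, 0 ≤ u → 0 ≤ ℓ u) (hℓ0 : ℓ 0 = 0)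
    (hA1i : ∀ r u : ℝ, 0 < r → r < 1 → 0 < u → r * ℓ u ≤ ℓ (r * u))
    (φ : ℝ → Vec d) (M : ℝ) (hM : 0 < M)
    (h : eSup01 φ ≤ ENNReal.ofReal M) :
    ENNReal.ofReal (ℓ M / M * ‖∫ s in (0:ℝ)..1, φ s‖) ≤
      ∫⁻ t in Icc (0:ℝ) 1, ENNReal.ofReal (ℓ ‖φ t‖) := by
  have hc : 0 ≤ ℓ M / M := div_nonneg (hℓnn M hM.le) hM.le
  calc ENNReal.ofReal (ℓ M / M * ‖∫ s in (0:ℝ)..1, φ s‖)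
      = ENNReal.ofReal (ℓ M / M) * ‖∫ s in Icc (0:ℝ) 1, φ s‖ₑ := by
        rw [ENNReal.ofReal_mul hc, intervalIntegral.integral_of_le zero_le_one,
          integral_Icc_eq_integral_Ioc, ofReal_norm]
    _ ≤ ENNReal.ofReal (ℓ M / M) * ∫⁻ t in Icc (0:ℝ) 1, ‖φ t‖ₑ := by
        gcongr
        exact enorm_integral_le_lintegral_enorm _
    _ = ∫⁻ t in Icc (0:ℝ) 1, ENNReal.ofReal (ℓ M / M) * ‖φ t‖ₑ := by
        rw [lintegral_const_mul' _ _ ENNReal.ofReal_ne_top]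
    _ ≤ _ := by
        apply lintegral_mono_ae
        filter_upwards [aux_ae_norm_le φ M hM.le h] with t ht
        rw [← ofReal_norm, ← ENNReal.ofReal_mul hc]
        exact ENNReal.ofReal_le_ofReal (aux_ell ℓ hℓ0 hA1i M _ hM (norm_nonneg _) ht)

theorem aux_TV_le_V {d : ℕ} (ℓ : ℝ → ℝ) (hℓnn : ∀ u : ℝ, 0 ≤ u → 0 ≤ ℓ u) (hℓ0 : ℓ 0 = 0)
    (hA1i : ∀ r u : ℝ, 0 < r → r < 1 → 0 < u → r * ℓ u ≤ ℓ (r * u))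
    (P₀ P₁ : Measure (Vec d)) (B : Set (Measure ℝ)) :
    TVval ℓ P₀ P₁ B ≤ Vval ℓ P₀ P₁ B := by
  apply le_sInf
  rintro c ⟨Ω, _, hP, ξ, φ, M, hξ, hφ, hM, hM0, hMB, hle, h0, h1, rfl⟩
  have hend : Measurable (fun ω => endPt (ξ ω) (φ ω)) := by
    unfold endPt
    simp only [intervalIntegral.integral_of_le zero_le_one]
    exact hξ.add (hφ.stronglyMeasurable.integral_prod_right
      (ν := volume.restrict (Ioc (0:ℝ) 1))).measurable
  refine le_trans (sInf_le ⟨Ω, _, hP, ξ, fun ω => endPt (ξ ω) (φ ω), M, hξ, hend, hM, hM0, hMB,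
    ?_, h0, h1, rfl⟩) ?_
  · filter_upwards [hM0, hle] with ω h2 h3
    simpa [endPt] using aux_integral_le (φ ω) (M ω) h2 h3
  · have hS : MeasurableSet {ω | 0 < M ω} := measurableSet_lt measurable_const hM
    refine le_trans ?_ (setLIntegral_le_lintegral {ω | 0 < M ω} _)
    apply lintegral_mono_ae
    filter_upwards [ae_restrict_mem hS, ae_restrict_of_ae hle] with ω h2 h3
    simpa [endPt] using aux_lower ℓ hℓnn hℓ0 hA1i (φ ω) (M ω) h2 h3

theorem aux_XVel_meas {d : ℕ} {Ω : Type} [MeasureSpace Ω] (X₀ X₁ : Ω → Vec d)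
    (h0 : Measurable X₀) (h1 : Measurable X₁) (A : Ω → Set ℝ) (hA : IsRandomSet Ω A) :
    Measurable (Function.uncurry (fun ω => XVel (X₀ ω) (X₁ ω) (A ω))) := by
  have hv : Measurable (fun ω => volume (A ω)) := measurable_measure_prodMk_left hA.2
  have hne : MeasurableSet {ω | X₀ ω ≠ X₁ ω ∧ 0 < volume (A ω)} :=
    (measurableSet_eq_fun h0 h1).compl.inter (measurableSet_lt measurable_const hv)
  have h : Function.uncurry (fun ω => XVel (X₀ ω) (X₁ ω) (A ω)) = fun p : Ω × ℝ =>
      if X₀ p.1 ≠ X₁ p.1 ∧ 0 < volume (A p.1) then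
        (if p.2 ∈ A p.1 then ((volume (A p.1)).toReal)⁻¹ • (X₁ p.1 - X₀ p.1) else 0) else 0 := by
    ext p : 1
    rfl
  rw [h]
  refine Measurable.ite (measurable_fst hne) (Measurable.ite hA.2 ?_ measurable_const)
    measurable_const
  exact ((hv.comp measurable_fst).ennreal_toReal.inv).smul
    ((h1.comp measurable_fst).sub (h0.comp measurable_fst))

/-- Pointwise facts on the path `X(·;x,y,A)`. -/
theorem aux_path {d : ℕ} (ℓ : ℝ → ℝ) (hℓ0 : ℓ 0 = 0)
    (x y : Vec d) (A : Set ℝ) (hA : MeasurableSet A) (hA01 : A ⊆ Icc (0:ℝ) 1)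
    (M : ℝ) (hM : 0 ≤ M) (hxy : ‖y - x‖ ≤ M)
    (hsize : 0 < M → (volume A).toReal = ‖y - x‖ / M) :
    eSup01 (XVel x y A) ≤ ENNReal.ofReal M ∧ endPt x (XVel x y A) = y ∧
    (∫⁻ t in Icc (0:ℝ) 1, ENNReal.ofReal (ℓ ‖XVel x y A t‖)) =
      if 0 < M then ENNReal.ofReal (ℓ M / M * ‖y - x‖) else 0 := by
  by_cases hne : x = y
  · subst hne
    have h : XVel x x A = fun _ => 0 := by ext1 s; simp [XVel]
    rw [h]
    refine ⟨?_, ?_, ?_⟩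
    · refine essSup_le_of_ae_le _ (Eventually.of_forall fun s => ?_)
      simp
    · simp [endPt]
    · simp [hℓ0]
  have hn : 0 < ‖y - x‖ := norm_pos_iff.2 (sub_ne_zero.2 (Ne.symm hne))
  have hM' : 0 < M := hn.trans_le hxy
  have hs := hsize hM'
  have hvpos : 0 < (volume A).toReal := by rw [hs]; positivity
  have hv0 : 0 < volume A := (ENNReal.toReal_pos_iff.1 hvpos).1
  have hvtop : volume A ≠ ⊤ := (ENNReal.toReal_pos_iff.1 hvpos).2.ne
  have hX : XVel x y A = A.indicator (fun _ => ((volume A).toReal)⁻¹ • (y - x)) := by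
    ext1 s
    simp [XVel, hne, hv0, Set.indicator]
  have hnorm : ‖((volume A).toReal)⁻¹ • (y - x)‖ = M := by
    rw [norm_smul, hs, Real.norm_of_nonneg (by positivity)]
    field_simp
  refine ⟨?_, ?_, ?_⟩
  · refine essSup_le_of_ae_le _ (Eventually.of_forall fun s => ?_)
    have : ‖XVel x y A s‖ ≤ M := by
      rw [hX, Set.indicator_apply]
      split_ifs
      · exact hnorm.le
      · simpa using hM
    change (‖XVel x y A s‖₊ : ℝ≥0∞) ≤ ENNReal.ofReal M
    rw [← enorm_eq_nnnorm, ← ofReal_norm]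
    exact ENNReal.ofReal_le_ofReal this
  · rw [endPt, intervalIntegral.integral_of_le zero_le_one, ← integral_Icc_eq_integral_Ioc, hX,
      setIntegral_indicator hA, Set.inter_eq_right.2 hA01, setIntegral_const, smul_smul,
      Measure.real, mul_inv_cancel₀ hvpos.ne', one_smul, add_sub_cancel]
  · rw [if_pos hM']
    have h : (fun t => ENNReal.ofReal (ℓ ‖XVel x y A t‖)) =
        A.indicator (fun _ => ENNReal.ofReal (ℓ M)) := by
      ext1 s
      rw [hX, Set.indicator_apply, Set.indicator_apply]
      split_ifs
      · rw [hnorm]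
      · simp [hℓ0]
    rw [h, setLIntegral_indicator hA, Set.inter_eq_left.2 hA01, setLIntegral_const,
      ← ENNReal.ofReal_toReal hvtop, hs, ← ENNReal.ofReal_mul' (by positivity)]
    congr 1
    ring

/-- Theorem 2.3 (ii): under (A1,i), if `(X₀,X₁,M)` is a minimizer of
`T^V(P₀,P₁;B)` and `A` is a random measurable subset of `[0,1]` on the same probability
space with `P(|A| = |X₁-X₀|/M | M > 0) = 1`, then `(X(·;X₀,X₁,A), M)` is a minimizer of
`V(P₀,P₁;B)`. -/
theorem statement9 {d : ℕ} (hd : 1 ≤ d) (ℓ : ℝ → ℝ)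
    (hℓnn : ∀ u : ℝ, 0 ≤ u → 0 ≤ ℓ u) (hℓ0 : ℓ 0 = 0)
    (hA1i : ∀ r u : ℝ, 0 < r → r < 1 → 0 < u → r * ℓ u ≤ ℓ (r * u))
    (P₀ P₁ : Measure (Vec d)) [IsProbabilityMeasure P₀] [IsProbabilityMeasure P₁]
    (B : Set (Measure ℝ))
    (Ω : Type) [MeasureSpace Ω] (X₀ X₁ : Ω → Vec d) (M : Ω → ℝ)
    (hmin : IsTVMin ℓ P₀ P₁ B Ω X₀ X₁ M)
    (A : Ω → Set ℝ) (hA : IsRandomSet Ω A)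
    (hAsize : ∀ᵐ ω ∂(volume : Measure Ω), 0 < M ω →
      (volume (A ω)).toReal = ‖X₁ ω - X₀ ω‖ / M ω) :
    IsVvalMin ℓ P₀ P₁ B Ω X₀ (fun ω => XVel (X₀ ω) (X₁ ω) (A ω)) M := by
  obtain ⟨⟨hP, hX0, hX1, hM, hM0, hMB, hle, h0, h1⟩, hval⟩ := hmin
  have hAm : ∀ ω, MeasurableSet (A ω) := fun ω => measurable_prodMk_left hA.2
  have key : ∀ᵐ ω ∂(volume : Measure Ω),
      eSup01 (XVel (X₀ ω) (X₁ ω) (A ω)) ≤ ENNReal.ofReal (M ω) ∧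
      endPt (X₀ ω) (XVel (X₀ ω) (X₁ ω) (A ω)) = X₁ ω ∧
      (∫⁻ t in Icc (0:ℝ) 1, ENNReal.ofReal (ℓ ‖XVel (X₀ ω) (X₁ ω) (A ω) t‖)) =
        if 0 < M ω then ENNReal.ofReal (ℓ (M ω) / M ω * ‖X₁ ω - X₀ ω‖) else 0 := by
    filter_upwards [hM0, hle, hAsize] with ω a b c
    exact aux_path ℓ hℓ0 _ _ _ (hAm ω) (hA.1 ω) _ a b c
  have hadm : IsVvalAdmissible P₀ P₁ B Ω X₀ (fun ω => XVel (X₀ ω) (X₁ ω) (A ω)) M := by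
    refine ⟨hP, hX0, aux_XVel_meas X₀ X₁ hX0 hX1 A hA, hM, hM0, hMB, ?_, h0, ?_⟩
    · filter_upwards [key] with ω h using h.1
    · rw [← h1]
      apply Measure.map_congr
      filter_upwards [key] with ω h using h.2.1
  refine ⟨hadm, ?_⟩
  have hS : MeasurableSet {ω | 0 < M ω} := measurableSet_lt measurable_const hM
  have hcost : (∫⁻ ω, ∫⁻ t in Icc (0:ℝ) 1,
      ENNReal.ofReal (ℓ ‖(fun ω => XVel (X₀ ω) (X₁ ω) (A ω)) ω t‖)) = TVval ℓ P₀ P₁ B := by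
    rw [← hval, ← lintegral_indicator hS]
    apply lintegral_congr_ae
    filter_upwards [key] with ω h
    rw [Set.indicator_apply]
    exact h.2.2
  apply le_antisymm
  · rw [hcost]
    exact aux_TV_le_V ℓ hℓnn hℓ0 hA1i P₀ P₁ B
  · obtain ⟨a1, a2, a3, a4, a5, a6, a7, a8, a9⟩ := hadm
    exact sInf_le ⟨Ω, _, a1, X₀, _, M, a2, a3, a4, a5, a6, a7, a8, a9, rfl⟩
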